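/- Let 𝕁 be an interval of the form ℝ, (α,∞) or [α,∞), X a complex Banach space and 1 ≤ p < ∞. Every Stepanov S^p-almost periodic function φ : 𝕁 → X can be written in the form φ = u + v' almost everywhere on 𝕁, where u, v ∈ AP(𝕁,X), v is locally absolutely continuous (v ∈ W^{1,1}_loc(𝕁,X)) and v' denotes its a.e. derivative. -/

import Mathlib

open MeasureTheory Set Filter

/-- Trigonometric polynomials `t ↦ Σ_j e^{iω_j t} • a_j`. -/
def TrigPolySet (X : Type*) [NormedAddCommGroup X] [Module ℂ X] : Set (ℝ → X) :=
  {f | ∃ (N : ℕ) (ω : Fin N → ℝ) (a : Fin N → X),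
    f = fun t : ℝ => ∑ j, Complex.exp (Complex.I * (ω j : ℂ) * (t : ℂ)) • a j}

/-- `AP(ℝ,X)`: uniform limits on `ℝ` of trigonometric polynomials. -/
def APR (X : Type*) [NormedAddCommGroup X] [Module ℂ X] : Set (ℝ → X) :=
  {f | ∃ π : ℕ → ℝ → X, (∀ n, π n ∈ TrigPolySet X) ∧ TendstoUniformly π f atTop}

/-- `AP(𝕁,X) := AP(ℝ,X)|_𝕁`: functions agreeing on `𝕁` with a Bohr ap function. -/
def APJ {X : Type*} [NormedAddCommGroup X] [Module ℂ X] (J : Set ℝ) : Set (ℝ → X) :=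
  {f | ∃ g ∈ APR X, ∀ t ∈ J, f t = g t}

section TrigPoly

theorem norm_exp_I_mul_ofReal_mul_ofReal (x y : ℝ) :
    ‖Complex.exp (Complex.I * (x : ℂ) * (y : ℂ))‖ = 1 := by
  rw [show Complex.I * (x : ℂ) * (y : ℂ) = ((x * y : ℝ) : ℂ) * Complex.I by push_cast; ring]
  exact Complex.norm_exp_ofReal_mul_I _

variable {X : Type*} [NormedAddCommGroup X]

theorem TrigPolySet.sub_mem [Module ℂ X] {f g : ℝ → X} (hf : f ∈ TrigPolySet X)
    (hg : g ∈ TrigPolySet X) : (fun t => f t - g t) ∈ TrigPolySet X := by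
  obtain ⟨N, ω, a, rfl⟩ := hf
  obtain ⟨M, η, b, rfl⟩ := hg
  refine ⟨N + M, Fin.append ω η, Fin.append a (fun j => -b j), ?_⟩
  funext t
  simp [Fin.sum_univ_add, sub_eq_add_neg]

/-- Finitely many frequencies have a common almost-period beyond any bound. -/
theorem exists_ge_norm_exp_sub_one_lt {N : ℕ} (ω : Fin N → ℝ) (T : ℝ) {ε : ℝ} (hε : 0 < ε) :
    ∃ τ : ℝ, T ≤ τ ∧ ∀ j, ‖Complex.exp (Complex.I * (ω j : ℂ) * (τ : ℂ)) - 1‖ < ε := by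
  set S : ℝ := max T 0
  let z : ℕ → Fin N → ℂ := fun k j => Complex.exp (Complex.I * (ω j : ℂ) * ((k * S : ℝ) : ℂ))
  have hz : ∀ k, z k ∈ Metric.closedBall (0 : Fin N → ℂ) 1 := fun k => by
    rw [mem_closedBall_zero_iff, pi_norm_le_iff_of_nonneg zero_le_one]
    exact fun j => (norm_exp_I_mul_ofReal_mul_ofReal _ _).le
  obtain ⟨l, -, ψ, hψ, hlim⟩ :=
    (isCompact_closedBall (0 : Fin N → ℂ) 1).tendsto_subseq hz
  obtain ⟨n, hn⟩ := Metric.cauchySeq_iff.1 hlim.cauchySeq ε hε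
  have hlt : ψ n < ψ (n + 1) := hψ n.lt_succ_self
  refine ⟨((ψ (n + 1) : ℝ) - ψ n) * S, ?_, fun j => ?_⟩
  · have h1 : (1 : ℝ) ≤ (ψ (n + 1) : ℝ) - ψ n := by
      have : ((ψ n + 1 : ℕ) : ℝ) ≤ ψ (n + 1) := by exact_mod_cast hlt
      push_cast at this; linarith
    have hS : 0 ≤ S := le_max_right _ _
    calc T ≤ S := le_max_left _ _
      _ ≤ _ := by nlinarith
  · have hd := hn (n + 1) n.le_succ n le_rfl
    have hj := (dist_le_pi_dist (z (ψ (n + 1))) (z (ψ n)) j).trans_lt hd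
    rw [dist_eq_norm] at hj
    have : z (ψ (n + 1)) j - z (ψ n) j = z (ψ n) j *
        (Complex.exp (Complex.I * (ω j : ℂ) * ((((ψ (n + 1) : ℝ) - ψ n) * S : ℝ) : ℂ)) - 1) := by
      simp only [z]
      rw [mul_sub, ← Complex.exp_add, mul_one]
      congr 2
      push_cast; ring
    rwa [this, norm_mul, norm_exp_I_mul_ofReal_mul_ofReal, one_mul] at hj

variable [NormedSpace ℂ X]

theorem TrigPolySet.continuous {f : ℝ → X} (hf : f ∈ TrigPolySet X) : Continuous f := by
  obtain ⟨N, ω, a, rfl⟩ := hf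
  fun_prop

/-- A bound for a trigonometric polynomial on an upper set of `ℝ` holds on all of `ℝ`. -/
theorem TrigPolySet.norm_le_of_isUpperSet {f : ℝ → X} (hf : f ∈ TrigPolySet X) {J : Set ℝ}
    (hJ : IsUpperSet J) (hne : J.Nonempty) {C : ℝ} (hC : ∀ t ∈ J, ‖f t‖ ≤ C) (t : ℝ) :
    ‖f t‖ ≤ C := by
  obtain ⟨N, ω, a, rfl⟩ := hf
  obtain ⟨x, hx⟩ := hne
  refine le_of_forall_pos_le_add fun ε hε => ?_
  set A : ℝ := ∑ j, ‖a j‖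
  have hA : 0 ≤ A := Finset.sum_nonneg fun _ _ => norm_nonneg _
  obtain ⟨τ, hτ, hτ'⟩ := exists_ge_norm_exp_sub_one_lt ω (x - t)
    (ε := ε / (A + 1)) (by positivity)
  have hmem : t + τ ∈ J := hJ (by linarith) hx
  have hdiff : ‖(∑ j, Complex.exp (Complex.I * (ω j : ℂ) * ((t + τ : ℝ) : ℂ)) • a j) -
      ∑ j, Complex.exp (Complex.I * (ω j : ℂ) * (t : ℂ)) • a j‖ ≤ ε := by
    rw [← Finset.sum_sub_distrib]
    calc _ ≤ ∑ j, ε / (A + 1) * ‖a j‖ := by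
          refine norm_sum_le_of_le _ fun j _ => ?_
          rw [← sub_smul, norm_smul]
          gcongr
          rw [show Complex.exp (Complex.I * (ω j : ℂ) * ((t + τ : ℝ) : ℂ)) -
              Complex.exp (Complex.I * (ω j : ℂ) * (t : ℂ)) =
              Complex.exp (Complex.I * (ω j : ℂ) * (t : ℂ)) *
              (Complex.exp (Complex.I * (ω j : ℂ) * (τ : ℂ)) - 1) by
            rw [mul_sub, ← Complex.exp_add, mul_one]; congr 2; push_cast; ring]
          rw [norm_mul, norm_exp_I_mul_ofReal_mul_ofReal, one_mul]
          exact (hτ' j).le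
      _ = ε / (A + 1) * A := by rw [← Finset.mul_sum]
      _ ≤ ε := by
          rw [div_mul_eq_mul_div, div_le_iff₀ (by positivity)]
          nlinarith
  have h1 := hC _ hmem
  have h2 := norm_sub_norm_le (∑ j, Complex.exp (Complex.I * (ω j : ℂ) * (t : ℂ)) • a j)
    (∑ j, Complex.exp (Complex.I * (ω j : ℂ) * ((t + τ : ℝ) : ℂ)) • a j)
  rw [norm_sub_rev] at h2
  simp only at h1 ⊢
  linarith

/-- A uniform limit on an upper set `J` of trigonometric polynomials belongs to `AP(J,X)`. -/
theorem mem_APJ_of_tendstoUniformlyOn [CompleteSpace X] {J : Set ℝ} (hJ : IsUpperSet J)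
    (hne : J.Nonempty) {π : ℕ → ℝ → X} (hπ : ∀ n, π n ∈ TrigPolySet X) {f : ℝ → X}
    (hf : TendstoUniformlyOn π f atTop J) : f ∈ APJ J := by
  have hcauchy : UniformCauchySeqOn π atTop univ := by
    rw [Metric.uniformCauchySeqOn_iff]
    intro ε hε
    obtain ⟨N, hN⟩ := Metric.uniformCauchySeqOn_iff.1 hf.uniformCauchySeqOn (ε / 2) (half_pos hε)
    refine ⟨N, fun m hm n hn t _ => ?_⟩
    have := TrigPolySet.norm_le_of_isUpperSet (TrigPolySet.sub_mem (hπ m) (hπ n)) hJ hne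
      (C := ε / 2)
      (fun s hs => by simpa [dist_eq_norm] using (hN m hm n hn s hs).le) t
    rw [dist_eq_norm]
    linarith
  have hlim : ∀ t, ∃ x, Tendsto (fun n => π n t) atTop (nhds x) := fun t =>
    cauchySeq_tendsto_of_complete (hcauchy.cauchySeq (mem_univ t))
  choose g hg using hlim
  refine ⟨g, ⟨π, hπ, ?_⟩, fun t ht => tendsto_nhds_unique (hf.tendsto_at ht) (hg t)⟩
  rw [← tendstoUniformlyOn_univ]
  exact hcauchy.tendstoUniformlyOn_of_tendsto fun t _ => hg t

end TrigPoly

section UpperSet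

variable {X : Type*} [NormedAddCommGroup X] {J : Set ℝ} {f : ℝ → X}

theorem intervalIntegrable_of_isUpperSet (hJ : IsUpperSet J)
    (hf : ∀ x ∈ J, IntervalIntegrable f volume x (x + 1)) {a b : ℝ} (ha : a ∈ J) (hb : b ∈ J) :
    IntervalIntegrable f volume a b := by
  have key : ∀ c ∈ J, ∀ d, c ≤ d → IntervalIntegrable f volume c d := by
    intro c hc d hcd
    obtain ⟨n, hn⟩ := exists_nat_ge (d - c)
    have h : IntervalIntegrable f volume (c + (0 : ℕ)) (c + (n : ℕ)) :=
      IntervalIntegrable.trans_iterate (a := fun k : ℕ => c + (k : ℝ)) fun k _ => by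
        have := hf (c + k) (hJ (by simp) hc)
        simpa [add_assoc] using this
    simp only [Nat.cast_zero, add_zero] at h
    refine h.mono_set ?_
    rw [uIcc_of_le hcd, uIcc_of_le (by simp)]
    exact Icc_subset_Icc_right (by linarith)
  rcases le_total a b with h | h
  · exact key a ha b h
  · exact (key b hb a h).symm

theorem locallyIntegrableOn_of_isUpperSet (hJ : IsUpperSet J) (hJc : IsLocallyClosed J)
    (hf : ∀ x ∈ J, IntervalIntegrable f volume x (x + 1)) : LocallyIntegrableOn f J := by
  rw [locallyIntegrableOn_iff hJc]
  intro k hkJ hk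
  rcases k.eq_empty_or_nonempty with rfl | hne
  · exact integrableOn_empty
  obtain ⟨a, ha, hak⟩ := hk.exists_isLeast hne
  obtain ⟨b, hb, hbk⟩ := hk.exists_isGreatest hne
  have hi := intervalIntegrable_of_isUpperSet hJ hf (hkJ ha) (hkJ hb)
  rw [intervalIntegrable_iff_integrableOn_Icc_of_le (hak hb)] at hi
  exact hi.mono_set fun x hx => ⟨hak hx, hbk hx⟩

end UpperSet

section MovingAverage

variable {X : Type*} [NormedAddCommGroup X] [NormedSpace ℝ X]

/-- The forward moving average `t ↦ ∫_t^{t+1} f`. -/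
noncomputable def movingAverage (f : ℝ → X) (t : ℝ) : X := ∫ r in t..(t + 1), f r

/-- `t ↦ -∫_0^1 ∫_t^{t+s} f`, whose derivative is `f - movingAverage f`. -/
noncomputable def averagedPrimitive (f : ℝ → X) (t : ℝ) : X :=
  -∫ s in (0 : ℝ)..1, ∫ r in t..(t + s), f r

section Trig

variable [NormedSpace ℂ X] [CompleteSpace X]

theorem integral_trigPoly {N : ℕ} (ω : Fin N → ℝ) (a : Fin N → X) (t s : ℝ) :
    ∫ r in t..(t + s), ∑ j, Complex.exp (Complex.I * (ω j : ℂ) * (r : ℂ)) • a j =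
      ∑ j, (Complex.exp (Complex.I * (ω j : ℂ) * (t : ℂ)) *
        ∫ r in (0 : ℝ)..s, Complex.exp (Complex.I * (ω j : ℂ) * (r : ℂ))) • a j := by
  rw [intervalIntegral.integral_finsetSum
    fun j _ => Continuous.intervalIntegrable (by fun_prop) _ _]
  refine Finset.sum_congr rfl fun j _ => ?_
  rw [intervalIntegral.integral_smul_const, ← intervalIntegral.integral_const_mul]
  congr 1
  have h := intervalIntegral.integral_comp_add_left (a := 0) (b := s)
    (fun r : ℝ => Complex.exp (Complex.I * (ω j : ℂ) * (r : ℂ))) t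
  rw [add_zero] at h
  rw [← h]
  refine intervalIntegral.integral_congr fun r _ => ?_
  rw [← Complex.exp_add]
  congr 1
  push_cast; ring

theorem movingAverage_mem_trigPolySet {f : ℝ → X} (hf : f ∈ TrigPolySet X) :
    movingAverage f ∈ TrigPolySet X := by
  obtain ⟨N, ω, a, rfl⟩ := hf
  refine ⟨N, ω, fun j =>
    (∫ r in (0 : ℝ)..1, Complex.exp (Complex.I * (ω j : ℂ) * (r : ℂ))) • a j, ?_⟩
  funext t
  simp only [movingAverage, integral_trigPoly, mul_smul]

theorem averagedPrimitive_mem_trigPolySet {f : ℝ → X} (hf : f ∈ TrigPolySet X) :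
    averagedPrimitive f ∈ TrigPolySet X := by
  obtain ⟨N, ω, a, rfl⟩ := hf
  refine ⟨N, ω, fun j => -((∫ s in (0 : ℝ)..1,
    ∫ r in (0 : ℝ)..s, Complex.exp (Complex.I * (ω j : ℂ) * (r : ℂ))) • a j), ?_⟩
  funext t
  have hc : ∀ j, Continuous fun s : ℝ =>
      ∫ r in (0 : ℝ)..s, Complex.exp (Complex.I * (ω j : ℂ) * (r : ℂ)) := fun j =>
    intervalIntegral.continuous_primitive
      (fun _ _ => Continuous.intervalIntegrable (by fun_prop) _ _) 0
  simp only [averagedPrimitive, integral_trigPoly]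
  rw [intervalIntegral.integral_finsetSum
    fun j _ => Continuous.intervalIntegrable (by have := hc j; fun_prop) _ _,
    ← Finset.sum_neg_distrib]
  refine Finset.sum_congr rfl fun j _ => ?_
  rw [intervalIntegral.integral_smul_const, intervalIntegral.integral_const_mul, mul_smul, smul_neg]

end Trig

theorem norm_integral_sub_le {f h : ℝ → X} {t s : ℝ} (hs : s ∈ Icc (0 : ℝ) 1)
    (hf : IntervalIntegrable f volume t (t + 1)) (hh : IntervalIntegrable h volume t (t + 1)) :
    ‖(∫ r in t..(t + s), f r) - ∫ r in t..(t + s), h r‖ ≤ ∫ r in t..(t + 1), ‖f r - h r‖ := by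
  have hsub : uIcc t (t + s) ⊆ uIcc t (t + 1) := by
    rw [uIcc_of_le (by linarith [hs.1]), uIcc_of_le (by linarith)]
    exact Icc_subset_Icc_right (by linarith [hs.2])
  rw [← intervalIntegral.integral_sub (hf.mono_set hsub) (hh.mono_set hsub)]
  refine (intervalIntegral.norm_integral_le_integral_norm (by linarith [hs.1])).trans ?_
  exact intervalIntegral.integral_mono_interval le_rfl (by linarith [hs.1]) (by linarith [hs.2])
    (Eventually.of_forall fun _ => norm_nonneg _) (hf.sub hh).norm

theorem norm_movingAverage_sub_le {f h : ℝ → X} {t : ℝ}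
    (hf : IntervalIntegrable f volume t (t + 1)) (hh : IntervalIntegrable h volume t (t + 1)) :
    ‖movingAverage f t - movingAverage h t‖ ≤ ∫ r in t..(t + 1), ‖f r - h r‖ :=
  norm_integral_sub_le ⟨zero_le_one, le_rfl⟩ hf hh

theorem continuousOn_integral_add {f : ℝ → X} {t : ℝ}
    (hf : IntervalIntegrable f volume t (t + 1)) :
    ContinuousOn (fun s => ∫ r in t..(t + s), f r) (uIcc 0 1) := by
  refine (intervalIntegral.continuousOn_primitive_interval' hf left_mem_uIcc).comp
    (by fun_prop) fun s hs => ?_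
  rw [uIcc_of_le zero_le_one] at hs
  rw [uIcc_of_le (by linarith)]
  exact ⟨by linarith [hs.1], by linarith [hs.2]⟩

theorem norm_averagedPrimitive_sub_le {f h : ℝ → X} {t : ℝ}
    (hf : IntervalIntegrable f volume t (t + 1)) (hh : IntervalIntegrable h volume t (t + 1)) :
    ‖averagedPrimitive f t - averagedPrimitive h t‖ ≤ ∫ r in t..(t + 1), ‖f r - h r‖ := by
  rw [averagedPrimitive, averagedPrimitive, neg_sub_neg, norm_sub_rev,
    ← intervalIntegral.integral_sub (continuousOn_integral_add hf).intervalIntegrable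
      (continuousOn_integral_add hh).intervalIntegrable]
  refine (intervalIntegral.norm_integral_le_of_norm_le_const
    (C := ∫ r in t..(t + 1), ‖f r - h r‖) fun s hs => ?_).trans (by simp)
  rw [uIoc_of_le zero_le_one] at hs
  exact norm_integral_sub_le ⟨hs.1.le, hs.2⟩ hf hh

section Primitive

variable [CompleteSpace X] {J : Set ℝ} {f : ℝ → X}

/-- On an upper set, `averagedPrimitive f` is a primitive of `f - movingAverage f`. -/
theorem averagedPrimitive_eq_add_integral (hJ : IsUpperSet J)
    (hf : ∀ x ∈ J, IntervalIntegrable f volume x (x + 1)) {a t : ℝ} (ha : a ∈ J) (ht : t ∈ J) :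
    IntervalIntegrable (movingAverage f) volume a t ∧
    averagedPrimitive f t =
      averagedPrimitive f a + ∫ s in a..t, (f s - movingAverage f s) := by
  have hfi : ∀ {x y}, x ∈ J → y ∈ J → IntervalIntegrable f volume x y :=
    fun hx hy => intervalIntegrable_of_isUpperSet hJ hf hx hy
  have hsucc : ∀ {x s : ℝ}, x ∈ J → 0 ≤ s → x + s ∈ J := fun hx hs => hJ (by linarith) hx
  set F : ℝ → X := fun z => ∫ r in a..z, f r
  have hFi : ∀ {x y}, x ∈ J → y ∈ J → IntervalIntegrable F volume x y := by
    intro x y hx hy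
    have hc : ContinuousOn (fun z => F x + ∫ r in x..z, f r) (uIcc x y) :=
      continuousOn_const.add
        (intervalIntegral.continuousOn_primitive_interval' (hfi hx hy) left_mem_uIcc)
    refine (hc.congr fun z hz => ?_).intervalIntegrable
    exact (intervalIntegral.integral_add_adjacent_intervals (hfi ha hx)
      (hfi hx (hJ.ordConnected.uIcc_subset hx hy hz))).symm
  have hFsub : ∀ {x y}, x ∈ J → y ∈ J → ∫ r in x..y, f r = F y - F x := fun hx hy =>
    (intervalIntegral.integral_interval_sub_left (hfi ha hy) (hfi ha hx)).symm
  have hV : ∀ x ∈ J, averagedPrimitive f x = F x - ∫ z in x..(x + 1), F z := by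
    intro x hx
    have h1 : ∫ s in (0 : ℝ)..1, ∫ r in x..(x + s), f r =
        ∫ s in (0 : ℝ)..1, (F (x + s) - F x) := by
      refine intervalIntegral.integral_congr fun s hs => ?_
      rw [uIcc_of_le zero_le_one] at hs
      exact hFsub hx (hsucc hx hs.1)
    have h2 : IntervalIntegrable (fun s => F (x + s)) volume 0 1 := by
      simpa using (hFi hx (hsucc hx zero_le_one)).comp_add_left x
    rw [averagedPrimitive, h1, intervalIntegral.integral_sub h2 (by simp),
      intervalIntegral.integral_comp_add_left]
    simp
  have hU : EqOn (movingAverage f) (fun s => F (s + 1) - F s) (uIcc a t) := fun s hs => by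
    have hsJ := hJ.ordConnected.uIcc_subset ha ht hs
    exact hFsub hsJ (hsucc hsJ zero_le_one)
  have ha1 : a + 1 ∈ J := hsucc ha zero_le_one
  have ht1 : t + 1 ∈ J := hsucc ht zero_le_one
  have hFs : IntervalIntegrable (fun s => F (s + 1)) volume a t := by
    simpa using (hFi ha1 ht1).comp_add_right 1
  have hUi : IntervalIntegrable (movingAverage f) volume a t :=
    (hFs.sub (hFi ha ht)).congr fun s hs => (hU (uIoc_subset_uIcc hs)).symm
  refine ⟨hUi, ?_⟩
  rw [hV t ht, hV a ha, intervalIntegral.integral_sub (hfi ha ht) hUi,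
    intervalIntegral.integral_congr hU, intervalIntegral.integral_sub hFs (hFi ha ht),
    intervalIntegral.integral_comp_add_right]
  have e1 := intervalIntegral.integral_interval_sub_left (hFi ha ht1) (hFi ha ht)
  have e2 := intervalIntegral.integral_interval_sub_left (hFi ha ht1) (hFi ha ha1)
  have e0 : F a = 0 := intervalIntegral.integral_same
  rw [← e1, ← e2, e0]
  change F t - _ = _ + (F t - _)
  abel

end Primitive

end MovingAverage

section Stepanov

variable {X : Type*} [NormedAddCommGroup X]

theorem le_add_rpow_mul_rpow {p : ℝ} (hp : 1 ≤ p) {δ x : ℝ} (hδ : 0 < δ) (hx : 0 ≤ x) :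
    x ≤ δ + δ ^ (1 - p) * x ^ p := by
  have hnn : 0 ≤ δ ^ (1 - p) * x ^ p := by positivity
  rcases le_total x δ with h | h
  · linarith
  · have hx0 : 0 < x := hδ.trans_le h
    have h1 : x ^ (1 - p) ≤ δ ^ (1 - p) := Real.rpow_le_rpow_of_nonpos hδ h (by linarith)
    have h2 : x = x ^ (1 - p) * x ^ p := by
      rw [← Real.rpow_add hx0]; simp
    have h3 : x ^ (1 - p) * x ^ p ≤ δ ^ (1 - p) * x ^ p := by gcongr
    linarith

theorem integrable_of_norm_rpow {Ω : Type*} [MeasurableSpace Ω] {μ : Measure Ω}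
    [IsFiniteMeasure μ] {f : Ω → X} {p : ℝ} (hp : 1 ≤ p) (hf : AEStronglyMeasurable f μ)
    (hfp : Integrable (fun t => ‖f t‖ ^ p) μ) : Integrable f μ := by
  refine ((integrable_const (1 : ℝ)).add hfp).mono' hf (Eventually.of_forall fun t => ?_)
  simpa using le_add_rpow_mul_rpow hp one_pos (norm_nonneg (f t))

theorem integrable_norm_sub_rpow {Ω : Type*} [MeasurableSpace Ω] {μ : Measure Ω}
    {f h : Ω → X} {p : ℝ} (hp : 1 ≤ p) (hf : AEStronglyMeasurable f μ)
    (hfp : Integrable (fun t => ‖f t‖ ^ p) μ) (hh : MemLp h (ENNReal.ofReal p) μ) :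
    Integrable (fun t => ‖f t - h t‖ ^ p) μ := by
  have h0 : ENNReal.ofReal p ≠ 0 := by simpa using by linarith
  have hpR : (ENNReal.ofReal p).toReal = p := ENNReal.toReal_ofReal (by linarith)
  have hfL : MemLp f (ENNReal.ofReal p) μ := by
    rw [← integrable_norm_rpow_iff hf h0 ENNReal.ofReal_ne_top, hpR]
    exact hfp
  have := (hfL.sub hh).integrable_norm_rpow h0 ENNReal.ofReal_ne_top
  rw [hpR] at this
  exact this

/-- On unit intervals, a small `L^p` norm forces a small `L¹` norm. -/
theorem integral_norm_le_of_integral_norm_rpow_le {f : ℝ → X} {p : ℝ} (hp : 1 ≤ p) {x δ : ℝ}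
    (hδ : 0 < δ) (hf : IntervalIntegrable f volume x (x + 1))
    (hfp : IntervalIntegrable (fun t => ‖f t‖ ^ p) volume x (x + 1))
    (hle : ∫ t in x..(x + 1), ‖f t‖ ^ p ≤ δ ^ p) :
    ∫ t in x..(x + 1), ‖f t‖ ≤ 2 * δ := by
  have h1 : ∫ t in x..(x + 1), ‖f t‖ ≤ ∫ t in x..(x + 1), (δ + δ ^ (1 - p) * ‖f t‖ ^ p) :=
    intervalIntegral.integral_mono_on (by linarith) hf.norm
      (intervalIntegrable_const.add (hfp.const_mul _))
      fun t _ => le_add_rpow_mul_rpow hp hδ (norm_nonneg _)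
  rw [intervalIntegral.integral_add intervalIntegrable_const (hfp.const_mul _),
    intervalIntegral.integral_const_mul] at h1
  have h2 : δ ^ (1 - p) * ∫ t in x..(x + 1), ‖f t‖ ^ p ≤ δ ^ (1 - p) * δ ^ p := by gcongr
  rw [← Real.rpow_add hδ] at h2
  simp at h1 h2
  linarith

end Stepanov

/-- Corollary 5.4.  Every Stepanov `S^p`-almost periodic
`φ : 𝕁 → X` (1 ≤ p < ∞) can be written as `φ = u + v'` a.e. on `𝕁` with
`u, v ∈ AP(𝕁,X)` and `v ∈ W^{1,1}_loc(𝕁,X)` (encoded: `v(t) = v(α₀) + ∫_{α₀}^t g`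
with `g = v' ∈ L¹_loc(𝕁,X)`). -/
theorem cor_5_4 {X : Type*} [NormedAddCommGroup X] [NormedSpace ℝ X] [NormedSpace ℂ X]
    [IsScalarTower ℝ ℂ X] [CompleteSpace X]
    (J : Set ℝ) (α₀ : ℝ)
    (hJ : (J = Set.univ ∧ α₀ = 0) ∨
      ∃ α : ℝ, (J = Set.Ioi α ∨ J = Set.Ici α) ∧ α₀ = α + 1)
    (p : ℝ) (hp : 1 ≤ p)
    (φ : ℝ → X)
    (hmeas : AEStronglyMeasurable φ (volume.restrict J))
    (hLp : ∀ x ∈ J, IntegrableOn (fun t => ‖φ t‖ ^ p) (Set.Icc x (x + 1)))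
    (hSp : ∃ π : ℕ → ℝ → X, (∀ n, π n ∈ TrigPolySet X) ∧
      ∀ ε : ℝ, 0 < ε → ∃ N : ℕ, ∀ n ≥ N, ∀ x ∈ J,
        (∫ t in x..(x + 1), ‖φ t - π n t‖ ^ p) ≤ ε) :
    ∃ u v g : ℝ → X, u ∈ APJ J ∧ v ∈ APJ J ∧
      LocallyIntegrableOn g J ∧
      (∀ t ∈ J, v t = v α₀ + ∫ s in α₀..t, g s) ∧
      ∀ᵐ t ∂(volume.restrict J), φ t = u t + g t := by
  have hup : IsUpperSet J := by
    rcases hJ with ⟨rfl, -⟩ | ⟨α, rfl | rfl, -⟩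
    exacts [isUpperSet_univ, isUpperSet_Ioi α, isUpperSet_Ici α]
  have hlc : IsLocallyClosed J := by
    rcases hJ with ⟨rfl, -⟩ | ⟨α, rfl | rfl, -⟩
    exacts [isOpen_univ.isLocallyClosed, isOpen_Ioi.isLocallyClosed, isClosed_Ici.isLocallyClosed]
  have hα₀ : α₀ ∈ J := by
    rcases hJ with ⟨rfl, -⟩ | ⟨α, rfl | rfl, rfl⟩ <;> simp
  have hle : ∀ x : ℝ, x ≤ x + 1 := fun x => by linarith
  have hm : ∀ x ∈ J, AEStronglyMeasurable φ (volume.restrict (Icc x (x + 1))) := fun x hx =>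
    hmeas.mono_measure (Measure.restrict_mono (fun y hy => hup hy.1 hx) le_rfl)
  have hφ : ∀ x ∈ J, IntervalIntegrable φ volume x (x + 1) := fun x hx =>
    (intervalIntegrable_iff_integrableOn_Icc_of_le (hle x)).2
      (integrable_of_norm_rpow hp (hm x hx) (hLp x hx))
  obtain ⟨π, hπ, hlim⟩ := hSp
  have hπi : ∀ n x, IntervalIntegrable (π n) volume x (x + 1) := fun n x =>
    (TrigPolySet.continuous (hπ n)).intervalIntegrable _ _
  have hlim₁ : ∀ ε : ℝ, 0 < ε → ∃ N : ℕ, ∀ n ≥ N, ∀ x ∈ J,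
      ∫ t in x..(x + 1), ‖φ t - π n t‖ < ε := by
    intro ε hε
    obtain ⟨N, hN⟩ := hlim ((ε / 4) ^ p) (by positivity)
    refine ⟨N, fun n hn x hx => ?_⟩
    have hπp : MemLp (π n) (ENNReal.ofReal p) (volume.restrict (Icc x (x + 1))) := by
      have hc := TrigPolySet.continuous (hπ n)
      obtain ⟨C, hC⟩ := isCompact_Icc.exists_bound_of_continuousOn (s := Icc x (x + 1))
        hc.continuousOn
      exact MemLp.of_bound hc.aestronglyMeasurable C
        ((ae_restrict_iff' measurableSet_Icc).2 (Eventually.of_forall hC))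
    have h := integral_norm_le_of_integral_norm_rpow_le hp (by positivity : 0 < ε / 4)
      ((hφ x hx).sub (hπi n x))
      ((intervalIntegrable_iff_integrableOn_Icc_of_le (hle x)).2
        (integrable_norm_sub_rpow hp (hm x hx) (hLp x hx) hπp)) (hN n hn x hx)
    linarith
  refine ⟨movingAverage φ, averagedPrimitive φ, fun t => φ t - movingAverage φ t,
    ?_, ?_, ?_, ?_, ?_⟩
  · refine mem_APJ_of_tendstoUniformlyOn hup ⟨α₀, hα₀⟩
      (fun n => movingAverage_mem_trigPolySet (hπ n)) (Metric.tendstoUniformlyOn_iff.2 ?_)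
    intro ε hε
    obtain ⟨N, hN⟩ := hlim₁ ε hε
    filter_upwards [eventually_ge_atTop N] with n hn x hx
    rw [dist_eq_norm]
    exact (norm_movingAverage_sub_le (hφ x hx) (hπi n x)).trans_lt (hN n hn x hx)
  · refine mem_APJ_of_tendstoUniformlyOn hup ⟨α₀, hα₀⟩
      (fun n => averagedPrimitive_mem_trigPolySet (hπ n)) (Metric.tendstoUniformlyOn_iff.2 ?_)
    intro ε hε
    obtain ⟨N, hN⟩ := hlim₁ ε hε
    filter_upwards [eventually_ge_atTop N] with n hn x hx
    rw [dist_eq_norm]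
    exact (norm_averagedPrimitive_sub_le (hφ x hx) (hπi n x)).trans_lt (hN n hn x hx)
  · exact locallyIntegrableOn_of_isUpperSet hup hlc fun x hx => (hφ x hx).sub
      (averagedPrimitive_eq_add_integral hup hφ hx (hup (hle x) hx)).1
  · exact fun t ht => (averagedPrimitive_eq_add_integral hup hφ hα₀ ht).2
  · exact Eventually.of_forall fun t => (add_sub_cancel _ _).symm
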